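/- Let d ≥ 1, m ≥ -d, σ > 0, let h_t be the Mehler heat kernel of L = -Δ + |x|² + m, and fix A > 0 with tanh(A) = 1/2. Then there exists c = c(σ,d,m) > 0 such that ∫₀^A | h_t(x, x+y) − h_t(x, x−y) | t^{-(1+σ)} dt ≤ c |x| / |y|^{max(d+2σ−3,0)} for all x ∈ ℝ^d and all y with 0 < |y| ≤ 1. -/

import Mathlib

open MeasureTheory Set Filter
open RealInnerProductSpace

/-- The Mehler heat kernel of the Hermite-type operator `L = -Δ + |x|² + m` on `ℝ^d`. -/
noncomputable def mehler (d : ℕ) (m : ℝ) (t : ℝ)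
    (x y : EuclideanSpace ℝ (Fin d)) : ℝ :=
  Real.exp (-t * m) * (2 * Real.pi * Real.sinh (2 * t)) ^ (-(d : ℝ) / 2) *
    Real.exp (-‖x - y‖ ^ 2 / (2 * Real.tanh (2 * t)) - Real.tanh t * ⟪x, y⟫)

lemma Real.sinh_le_mul_cosh {t : ℝ} (ht : 0 ≤ t) : Real.sinh t ≤ t * Real.cosh t := by
  have hderiv : ∀ s : ℝ, HasDerivAt (fun s => s * Real.cosh s - Real.sinh s)
      (1 * Real.cosh s + s * Real.sinh s - Real.cosh s) s := fun s =>
    ((hasDerivAt_id s).mul (Real.hasDerivAt_cosh s)).sub (Real.hasDerivAt_sinh s)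
  have hmono : MonotoneOn (fun s => s * Real.cosh s - Real.sinh s) (Ici 0) := by
    refine monotoneOn_of_deriv_nonneg (convex_Ici 0)
      (fun s _ => (hderiv s).continuousAt.continuousWithinAt)
      (fun s _ => (hderiv s).differentiableAt.differentiableWithinAt) fun s hs => ?_
    rw [interior_Ici, mem_Ioi] at hs
    rw [(hderiv s).deriv]
    have := mul_pos hs (Real.sinh_pos_iff.2 hs)
    linarith
  have := hmono self_mem_Ici ht ht
  simp only [Real.sinh_zero, zero_mul, sub_zero] at this
  linarith

lemma Real.tanh_le_self {t : ℝ} (ht : 0 ≤ t) : Real.tanh t ≤ t := by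
  rw [Real.tanh_eq_sinh_div_cosh, div_le_iff₀ (Real.cosh_pos t)]
  exact Real.sinh_le_mul_cosh ht

lemma Real.tanh_pos_of_pos {t : ℝ} (ht : 0 < t) : 0 < Real.tanh t := by
  rw [Real.tanh_eq_sinh_div_cosh]
  exact div_pos (Real.sinh_pos_iff.2 ht) (Real.cosh_pos t)

lemma Real.tanh_le_one (t : ℝ) : Real.tanh t ≤ 1 := by
  rw [Real.tanh_eq_sinh_div_cosh, div_le_one (Real.cosh_pos t)]
  exact (Real.sinh_lt_cosh t).le

lemma Real.abs_exp_neg_sub_exp_le (u : ℝ) :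
    |Real.exp (-u) - Real.exp u| ≤ 2 * |u| * Real.exp |u| := by
  have key : ∀ v : ℝ, 0 ≤ v → |Real.exp (-v) - Real.exp v| ≤ 2 * v * Real.exp v := by
    intro v hv
    rw [abs_sub_comm, abs_of_nonneg (sub_nonneg.2 (Real.exp_le_exp.2 (by linarith)))]
    have h : Real.exp (-v) = Real.exp v * Real.exp (-(2 * v)) := by
      rw [← Real.exp_add]; ring_nf
    rw [h]
    nlinarith [Real.exp_pos v, Real.add_one_le_exp (-(2 * v))]
  rcases le_total 0 u with hu | hu
  · simpa [abs_of_nonneg hu] using key u hu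
  · simpa [abs_of_nonpos hu, abs_sub_comm] using key (-u) (neg_nonneg.2 hu)

/-- The difference of two values of the Mehler kernel at points symmetric about `x`. -/
lemma mehler_add_sub_mehler_sub (d : ℕ) (m t : ℝ) (x y : EuclideanSpace ℝ (Fin d)) :
    mehler d m t x (x + y) - mehler d m t x (x - y) =
      Real.exp (-t * m) * (2 * Real.pi * Real.sinh (2 * t)) ^ (-(d : ℝ) / 2) *
        Real.exp (-‖y‖ ^ 2 / (2 * Real.tanh (2 * t))) *
        (Real.exp (-(Real.tanh t * ‖x‖ ^ 2)) *
          (Real.exp (-(Real.tanh t * ⟪x, y⟫)) - Real.exp (Real.tanh t * ⟪x, y⟫))) := by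
  have h₁ : x - (x + y) = -y := by abel
  have h₂ : x - (x - y) = y := by abel
  simp only [mehler, h₁, h₂, norm_neg, inner_add_right, inner_sub_right,
    real_inner_self_eq_norm_sq]
  have hadd (a b c : ℝ) :
      Real.exp (a - (b + c)) = Real.exp a * (Real.exp (-b) * Real.exp (-c)) := by
    rw [← Real.exp_add, ← Real.exp_add]
    ring_nf
  rw [mul_add, mul_sub, sub_eq_add_neg (Real.tanh t * _), hadd, hadd, neg_neg]
  ring

lemma exp_neg_mul_abs_exp_sub_exp_le {E : Type*} [NormedAddCommGroup E] [InnerProductSpace ℝ E]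
    {τ : ℝ} (hτ : 0 ≤ τ) (hτ1 : τ ≤ 1) (x y : E) (hy : ‖y‖ ≤ 1) :
    Real.exp (-(τ * ‖x‖ ^ 2)) * |Real.exp (-(τ * ⟪x, y⟫)) - Real.exp (τ * ⟪x, y⟫)| ≤
      2 * (τ * (‖x‖ * ‖y‖)) * Real.exp 1 := by
  have hu : |τ * ⟪x, y⟫| ≤ τ * (‖x‖ * ‖y‖) := by
    rw [abs_mul, abs_of_nonneg hτ]
    exact mul_le_mul_of_nonneg_left (abs_real_inner_le_norm x y) hτ
  calc
    _ ≤ Real.exp (-(τ * ‖x‖ ^ 2)) *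
        (2 * (τ * (‖x‖ * ‖y‖)) * Real.exp (τ * (‖x‖ * ‖y‖))) := by
      gcongr
      exact (Real.abs_exp_neg_sub_exp_le _).trans (by gcongr)
    _ = 2 * (τ * (‖x‖ * ‖y‖)) * Real.exp (-(τ * ‖x‖ ^ 2) + τ * (‖x‖ * ‖y‖)) := by
      rw [Real.exp_add]; ring
    _ ≤ _ := by
      gcongr
      have h : ‖x‖ * ‖y‖ - ‖x‖ ^ 2 ≤ 1 := by
        nlinarith [sq_nonneg (‖x‖ - ‖y‖ / 2), norm_nonneg y]
      nlinarith

lemma abs_mehler_add_sub_mehler_sub_le (d : ℕ) (m : ℝ) {t : ℝ} (ht : 0 < t)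
    (x y : EuclideanSpace ℝ (Fin d)) (hy : ‖y‖ ≤ 1) :
    |mehler d m t x (x + y) - mehler d m t x (x - y)| ≤
      2 * Real.exp (t * |m| + 1) * (‖x‖ * ‖y‖) *
        (t * t ^ (-(d : ℝ) / 2) * Real.exp (-(‖y‖ ^ 2 / 4 / t))) := by
  have ht2 : 0 < 2 * t := by linarith
  have hsinh : 2 * t ≤ Real.sinh (2 * t) := Real.self_le_sinh_iff.2 ht2.le
  have hbase : t ≤ 2 * Real.pi * Real.sinh (2 * t) := by nlinarith [Real.pi_gt_three]
  have hpow : (2 * Real.pi * Real.sinh (2 * t)) ^ (-(d : ℝ) / 2) ≤ t ^ (-(d : ℝ) / 2) :=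
    Real.rpow_le_rpow_of_nonpos ht hbase
      (div_nonpos_of_nonpos_of_nonneg (neg_nonpos.2 d.cast_nonneg) zero_le_two)
  have hpow0 : 0 ≤ (2 * Real.pi * Real.sinh (2 * t)) ^ (-(d : ℝ) / 2) :=
    Real.rpow_nonneg (ht.le.trans hbase) _
  have hgauss : -‖y‖ ^ 2 / (2 * Real.tanh (2 * t)) ≤ -(‖y‖ ^ 2 / 4 / t) := by
    rw [neg_div, neg_le_neg_iff, div_div]
    have := Real.tanh_pos_of_pos ht2
    have := Real.tanh_le_self ht2.le
    exact div_le_div_of_nonneg_left (by positivity) (by positivity) (by linarith)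
  have hmass : -t * m ≤ t * |m| := by nlinarith [neg_abs_le m]
  have hτ := Real.tanh_pos_of_pos ht
  rw [mehler_add_sub_mehler_sub, abs_mul, abs_mul (Real.exp (-(Real.tanh t * ‖x‖ ^ 2))),
    abs_of_nonneg (by positivity :
      0 ≤ Real.exp (-t * m) * (2 * Real.pi * Real.sinh (2 * t)) ^ (-(d : ℝ) / 2) *
        Real.exp (-‖y‖ ^ 2 / (2 * Real.tanh (2 * t)))), Real.abs_exp]
  calc
    _ ≤ Real.exp (t * |m|) * t ^ (-(d : ℝ) / 2) * Real.exp (-(‖y‖ ^ 2 / 4 / t)) *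
        (2 * (t * (‖x‖ * ‖y‖)) * Real.exp 1) := by
      refine mul_le_mul (by gcongr) ?_ (by positivity) (by positivity)
      refine (exp_neg_mul_abs_exp_sub_exp_le hτ.le (Real.tanh_le_one t) x y hy).trans ?_
      have := Real.tanh_le_self ht.le
      gcongr
    _ = _ := by rw [Real.exp_add]; ring

lemma Real.inv_substitution_rpow_mul_exp {q k t : ℝ} (ht : 0 < t) :
    (|(-1 : ℝ)| * t ^ ((-1 : ℝ) - 1)) •
        ((t ^ (-1 : ℝ)) ^ (q - 1 - 1) * Real.exp (-(k * t ^ (-1 : ℝ)))) =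
      t ^ (-q) * Real.exp (-(k / t)) := by
  rw [← Real.rpow_mul ht.le, Real.rpow_neg_one t, smul_eq_mul, abs_neg, abs_one, one_mul,
    ← mul_assoc, ← Real.rpow_add ht, div_eq_mul_inv]
  ring_nf

lemma integrableOn_rpow_neg_mul_exp_neg_div {q k : ℝ} (hq : 1 < q) (hk : 0 < k) :
    IntegrableOn (fun t : ℝ => t ^ (-q) * Real.exp (-(k / t))) (Ioi 0) := by
  have h := integrableOn_rpow_mul_exp_neg_mul_rpow (p := 1) (s := q - 1 - 1) (b := k)
    (by linarith) one_pos hk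
  have h' : IntegrableOn (fun s : ℝ => s ^ (q - 1 - 1) * Real.exp (-(k * s))) (Ioi 0) := by
    simpa only [Real.rpow_one, neg_mul] using h
  refine ((integrableOn_Ioi_comp_rpow_iff _ (by norm_num : (-1 : ℝ) ≠ 0)).2 h').congr_fun
    (fun t ht => Real.inv_substitution_rpow_mul_exp ht) measurableSet_Ioi

lemma integral_rpow_neg_mul_exp_neg_div {q k : ℝ} (hq : 1 < q) (hk : 0 < k) :
    ∫ t in Ioi (0 : ℝ), t ^ (-q) * Real.exp (-(k / t)) =
      (1 / k) ^ (q - 1) * Real.Gamma (q - 1) := by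
  rw [← Real.integral_rpow_mul_exp_neg_mul_Ioi (by linarith : 0 < q - 1) hk,
    ← integral_comp_rpow_Ioi (fun s => s ^ (q - 1 - 1) * Real.exp (-(k * s))) (by norm_num : (-1 : ℝ) ≠ 0)]
  exact setIntegral_congr_fun measurableSet_Ioi
    fun t ht => (Real.inv_substitution_rpow_mul_exp ht).symm

lemma Real.rpow_neg_le_rpow_sub_mul_rpow_neg {t A p q : ℝ} (ht : 0 < t) (htA : t ≤ A)
    (hpq : p ≤ q) : t ^ (-p) ≤ A ^ (q - p) * t ^ (-q) := by
  calc
    t ^ (-p) = t ^ (q - p) * t ^ (-q) := by rw [← Real.rpow_add ht]; ring_nf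
    _ ≤ _ := by
      gcongr

/-- For the Mehler heat kernel of `L = -Δ + |x|² + m` and `A > 0` with
`tanh A = 1/2`, one has
`∫₀^A |h_t(x,x+y) - h_t(x,x-y)| t^{-(1+σ)} dt ≤ c |x| / |y|^{max(d+2σ-3,0)}`
for all `x` and all `0 < |y| ≤ 1`. -/
theorem mehler_truncated_kernel_smoothness_estimate
    (d : ℕ) (hd : 1 ≤ d) (m : ℝ) (hm : -(d : ℝ) ≤ m) (σ : ℝ) (hσ : 0 < σ)
    (A : ℝ) (hA0 : 0 < A) (hA : Real.tanh A = 1 / 2) :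
    ∃ c > (0 : ℝ), ∀ x y : EuclideanSpace ℝ (Fin d), 0 < ‖y‖ → ‖y‖ ≤ 1 →
      (∫ t in Set.Ioo (0 : ℝ) A,
          |mehler d m t x (x + y) - mehler d m t x (x - y)| * t ^ (-(1 + σ)))
        ≤ c * ‖x‖ / ‖y‖ ^ max ((d : ℝ) + 2 * σ - 3) 0 := by
  set p : ℝ := (d : ℝ) / 2 + σ with hp
  set q : ℝ := max p (3 / 2) with hq
  have hpq : p ≤ q := le_max_left _ _
  have hq1 : 1 < q := lt_of_lt_of_le (by norm_num) (le_max_right p (3 / 2))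
  have hexponent : max ((d : ℝ) + 2 * σ - 3) 0 = 2 * q - 3 := by
    rw [hq, mul_max_of_nonneg _ _ zero_le_two, ← max_sub_sub_right, hp]
    ring_nf
  set K : ℝ := 2 * Real.exp (A * |m| + 1) * A ^ (q - p) with hK
  have hΓ : 0 < Real.Gamma (q - 1) := Real.Gamma_pos_of_pos (by linarith)
  refine ⟨K * (4 ^ (q - 1) * Real.Gamma (q - 1)), by positivity, fun x y hy0 hy1 => ?_⟩
  have hk : 0 < ‖y‖ ^ 2 / 4 := by positivity
  have hint : IntegrableOn
      (fun t : ℝ => K * (‖x‖ * ‖y‖) * (t ^ (-q) * Real.exp (-(‖y‖ ^ 2 / 4 / t)))) (Ioi 0) :=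
    (integrableOn_rpow_neg_mul_exp_neg_div hq1 hk).const_mul (K * (‖x‖ * ‖y‖))
  have hbound : ∀ t ∈ Ioo (0 : ℝ) A,
      |mehler d m t x (x + y) - mehler d m t x (x - y)| * t ^ (-(1 + σ)) ≤
        K * (‖x‖ * ‖y‖) * (t ^ (-q) * Real.exp (-(‖y‖ ^ 2 / 4 / t))) := by
    rintro t ⟨ht, htA⟩
    have hpow : t * t ^ (-(d : ℝ) / 2) * t ^ (-(1 + σ)) = t ^ (-p) := by
      nth_rewrite 1 [← Real.rpow_one t]
      rw [← Real.rpow_add ht, ← Real.rpow_add ht, hp]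
      ring_nf
    calc
      _ ≤ 2 * Real.exp (t * |m| + 1) * (‖x‖ * ‖y‖) *
          (t * t ^ (-(d : ℝ) / 2) * Real.exp (-(‖y‖ ^ 2 / 4 / t))) * t ^ (-(1 + σ)) := by
        gcongr
        exact abs_mehler_add_sub_mehler_sub_le d m ht x y hy1
      _ = 2 * Real.exp (t * |m| + 1) * (‖x‖ * ‖y‖) *
          (t ^ (-p) * Real.exp (-(‖y‖ ^ 2 / 4 / t))) := by rw [← hpow]; ring
      _ ≤ 2 * Real.exp (A * |m| + 1) * (‖x‖ * ‖y‖) *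
          (A ^ (q - p) * t ^ (-q) * Real.exp (-(‖y‖ ^ 2 / 4 / t))) := by
        gcongr
        exact Real.rpow_neg_le_rpow_sub_mul_rpow_neg ht htA.le hpq
      _ = _ := by rw [hK]; ring
  have hscale : ‖y‖ * (1 / (‖y‖ ^ 2 / 4)) ^ (q - 1) = 4 ^ (q - 1) / ‖y‖ ^ (2 * q - 3) := by
    have h2 : (‖y‖ ^ 2) ^ (q - 1) = ‖y‖ * ‖y‖ ^ (2 * q - 3) := by
      rw [← Real.rpow_natCast, ← Real.rpow_mul hy0.le, ← Real.rpow_one_add' hy0.le (by linarith)]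
      push_cast
      ring_nf
    rw [one_div_div, Real.div_rpow (by norm_num) (by positivity), h2]
    field_simp
  calc
    _ ≤ ∫ t in Ioo (0 : ℝ) A,
        K * (‖x‖ * ‖y‖) * (t ^ (-q) * Real.exp (-(‖y‖ ^ 2 / 4 / t))) := by
      refine integral_mono_of_nonneg ?_ (hint.mono_set Ioo_subset_Ioi_self) ?_
      · filter_upwards [ae_restrict_mem measurableSet_Ioo] with t ht
        exact mul_nonneg (abs_nonneg _) (Real.rpow_nonneg ht.1.le _)
      · filter_upwards [ae_restrict_mem measurableSet_Ioo] with t ht using hbound t ht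
    _ ≤ ∫ t in Ioi (0 : ℝ),
        K * (‖x‖ * ‖y‖) * (t ^ (-q) * Real.exp (-(‖y‖ ^ 2 / 4 / t))) := by
      refine setIntegral_mono_set hint ?_ Ioo_subset_Ioi_self.eventuallyLE
      filter_upwards [ae_restrict_mem measurableSet_Ioi] with t ht
      have := Real.rpow_nonneg (le_of_lt ht) (-q)
      simp only [Pi.zero_apply]
      positivity
    _ = K * ‖x‖ * Real.Gamma (q - 1) * (‖y‖ * (1 / (‖y‖ ^ 2 / 4)) ^ (q - 1)) := by
      rw [integral_const_mul, integral_rpow_neg_mul_exp_neg_div hq1 hk]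
      ring
    _ = _ := by
      rw [hscale, hexponent]
      ring
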